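/- arXiv:1505.02236 — 2 statements merged into one kernel-verified Lean document; each statement's English description precedes it below -/
import Mathlib

section
/- Let S be a noetherian scheme and r : P → Q a proper morphism of S-schemes such that for each point s ∈ S the base-changed morphism r_s : P_s → Q_s of fibers is a closed embedding. Then r is a closed embedding. -/
open AlgebraicGeometry CategoryTheory CategoryTheory.Limits

universe u

open TensorProduct in
lemma nakayama_surj {A B : Type u} [CommRing A] [CommRing B] [Algebra A B] [Module.Finite A B]
    (h : ∀ M : Ideal A, M.IsMaximal →
      Function.Surjective (algebraMap (A ⧸ M) ((A ⧸ M) ⊗[A] B))) :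
    Function.Surjective (algebraMap A B) := by
  set L : Submodule A B := LinearMap.range (Algebra.linearMap A B) with hL
  have key : ∀ M : Ideal A, M.IsMaximal → ∀ b : B, ∃ a : A,
      b - algebraMap A B a ∈ (M • ⊤ : Submodule A B) := by
    intro M hM b
    obtain ⟨x, hx⟩ := h M hM (1 ⊗ₜ b)
    obtain ⟨a, rfl⟩ := Ideal.Quotient.mk_surjective x
    refine ⟨a, ?_⟩
    rw [← Submodule.Quotient.mk_eq_zero]
    have e : (1 : A ⧸ M) ⊗ₜ[A] (b - algebraMap A B a) = 0 := by
      rw [TensorProduct.tmul_sub, ← hx, Algebra.TensorProduct.algebraMap_apply,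
        Algebra.algebraMap_eq_smul_one a, TensorProduct.tmul_smul, TensorProduct.smul_tmul',
        sub_eq_zero]
      congr 1
      rw [Algebra.smul_def, mul_one]; rfl
    have := congrArg (TensorProduct.quotTensorEquivQuotSMul B M) e
    simpa using! this
  have hsub : (⊤ : Submodule A (B ⧸ L)) = ⊥ := by
    by_contra hne
    have hann : Module.annihilator A (B ⧸ L) ≠ ⊤ := by
      intro h1
      apply hne
      rw [eq_bot_iff]
      intro x _
      have : (1 : A) ∈ Module.annihilator A (B ⧸ L) := by rw [h1]; trivial
      simpa using Module.mem_annihilator.mp this x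
    obtain ⟨M, hM, hle⟩ := Ideal.exists_le_maximal _ hann
    have hfg : (⊤ : Submodule A (B ⧸ L)).FG := Module.Finite.fg_top
    have hs : (⊤ : Submodule A (B ⧸ L)) ≤ M • ⊤ := by
      intro x _
      obtain ⟨b, rfl⟩ := Submodule.mkQ_surjective _ x
      obtain ⟨a, ha⟩ := key M hM b
      have h2 := Submodule.mem_map_of_mem (f := L.mkQ) ha
      rw [Submodule.map_smul''] at h2
      have h3 : L.mkQ (algebraMap A B a) = 0 := by
        simp only [Submodule.mkQ_apply, Submodule.Quotient.mk_eq_zero]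
        exact ⟨a, rfl⟩
      rw [map_sub, h3, sub_zero] at h2
      exact Submodule.smul_mono le_rfl le_top h2
    obtain ⟨r, hr, hr'⟩ :=
      Submodule.exists_sub_one_mem_and_smul_eq_zero_of_fg_of_le_smul M _ hfg hs
    have : r ∈ M := hle (Module.mem_annihilator.mpr fun x => hr' x trivial)
    exact hM.ne_top ((Ideal.eq_top_iff_one _).mpr (by simpa using M.sub_mem this hr))
  intro b
  have : L.mkQ b = 0 := by
    have h1 : L.mkQ b ∈ (⊤ : Submodule A (B ⧸ L)) := trivial
    rw [hsub] at h1; simpa using h1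
  simp only [Submodule.mkQ_apply, Submodule.Quotient.mk_eq_zero] at this
  exact this

lemma surj_of_spec {R S : CommRingCat.{u}} (f : R ⟶ S) (h : IsClosedImmersion (Spec.map f)) :
    Function.Surjective f := by
  have h1 := (IsClosedImmersion.isAffine_surjective_of_isAffine (Spec.map f)).2
  have e : f = (Scheme.ΓSpecIso R).inv ≫ (Spec.map f).appTop ≫ (Scheme.ΓSpecIso S).hom := by
    simp
  rw [e]
  exact (ConcreteCategory.bijective_of_isIso (Scheme.ΓSpecIso S).hom).2.comp
    (h1.comp (ConcreteCategory.bijective_of_isIso (Scheme.ΓSpecIso R).inv).2)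

lemma finite_fiberwise {X Y : Scheme.{u}} (f : X ⟶ Y) [IsFinite f]
    (hf : ∀ (K : Type u) (_ : Field K) (t : Spec (.of K) ⟶ Y),
      IsClosedImmersion (pullback.snd f t)) : IsClosedImmersion f := by
  change id _
  wlog hY : ∃ R, Y = Spec R
  · refine (IsZariskiLocalAtTarget.iff_of_openCover (P := @IsClosedImmersion)
      Y.affineCover).mpr fun i ↦ this (pullback.snd _ _) (fun K hK t ↦ ?_) ⟨_, rfl⟩
    have := hf K hK (t ≫ Y.affineCover.f i)
    rw [← pullbackLeftPullbackSndIso_hom_snd] 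
    infer_instance
  obtain ⟨R, rfl⟩ := hY
  wlog hX : ∃ S, X = Spec S
  · have hXa : IsAffine X := isAffine_of_isAffineHom f
    refine (MorphismProperty.cancel_left_of_respectsIso @IsClosedImmersion
      (Scheme.isoSpec X).inv f).mp (this R _ (fun K hK t ↦ ?_) ⟨_, rfl⟩)
    have := hf K hK t
    have e : pullback.snd (X.isoSpec.inv ≫ f) t =
      pullback.map (X.isoSpec.inv ≫ f) t f t X.isoSpec.inv (𝟙 _) (𝟙 _) (by simp) (by simp) ≫
        pullback.snd f t := ((pullback.lift_snd _ _ _).trans (Category.comp_id _)).symm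
    rw [e]
    infer_instance
  obtain ⟨S, rfl⟩ := hX
  obtain ⟨φ, rfl⟩ := Spec.map_surjective f
  apply IsClosedImmersion.spec_of_surjective
  have hfin : φ.hom.Finite := (IsFinite.SpecMap_iff _).mp inferInstance
  algebraize [φ.hom]
  refine nakayama_surj (A := R) (B := S) fun M hM ↦ ?_
  have h1 := hf (R ⧸ M) (Ideal.Quotient.field M)
    (Spec.map (CommRingCat.ofHom (algebraMap R (R ⧸ M))))
  have h2 : IsClosedImmersion (Spec.map (CommRingCat.ofHom
      (algebraMap (R ⧸ M) (TensorProduct R (R ⧸ M) S)))) := by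
    have e : (pullbackSpecIso R (R ⧸ M) S).inv ≫ (pullbackSymmetry _ _).hom ≫ pullback.snd _ _ =
        Spec.map (CommRingCat.ofHom (algebraMap (R ⧸ M) (TensorProduct R (R ⧸ M) S))) := by
      rw [pullbackSymmetry_hom_comp_snd]
      exact pullbackSpecIso_inv_fst' R (R ⧸ M) S
    rw [← e, MorphismProperty.cancel_left_of_respectsIso @IsClosedImmersion,
      MorphismProperty.cancel_left_of_respectsIso @IsClosedImmersion]
    exact h1
  exact surj_of_spec _ h2

theorem isClosedImmersion_of_fiberwise_closedImmersion
    {P Q S : Scheme.{u}} [IsNoetherian S]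
    (p : P ⟶ S) (q : Q ⟶ S) (r : P ⟶ Q) (w : r ≫ q = p) [IsProper r]
    (hfib : ∀ s : S, IsClosedImmersion
      (pullback.map p (S.fromSpecResidueField s) q (S.fromSpecResidueField s)
        r (𝟙 _) (𝟙 _) (by rw [← w]; simp) (by simp))) :
    IsClosedImmersion r := by
  have key : ∀ (K : Type u) (_ : Field K) (t : Spec (.of K) ⟶ Q),
      IsClosedImmersion (pullback.snd r t) := by
    intro K hK t
    obtain ⟨s, g, hg⟩ : ∃ (s : S) (g : Spec (.of K) ⟶ Spec (S.residueField s)),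
        g ≫ S.fromSpecResidueField s = t ≫ q :=
      ⟨_, _, (Scheme.SpecToEquivOfField K S).left_inv (t ≫ q)⟩
    have := hfib s
    have sq : IsPullback (pullback.fst p (S.fromSpecResidueField s))
        (pullback.map p (S.fromSpecResidueField s) q (S.fromSpecResidueField s)
        r (𝟙 _) (𝟙 _) (by rw [← w]; simp) (by simp)) r
        (pullback.fst q (S.fromSpecResidueField s)) := by
      refine IsPullback.of_bot (v₂₁ := pullback.snd q (S.fromSpecResidueField s))
        (h₃₁ := S.fromSpecResidueField s) (v₁₂ := r) (v₂₂ := q) ?_ ?_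
        (IsPullback.of_hasPullback _ _).flip.flip
      · have h := IsPullback.of_hasPullback p (S.fromSpecResidueField s)
        have e : pullback.map p (S.fromSpecResidueField s) q (S.fromSpecResidueField s)
            r (𝟙 _) (𝟙 _) (by rw [← w]; simp) (by simp) ≫
            pullback.snd q (S.fromSpecResidueField s) = pullback.snd p _ :=
          (pullback.lift_snd _ _ _).trans (Category.comp_id _)
        rw [e, w]
        exact h
      · exact (pullback.lift_fst _ _ _).symm
    let t' : Spec (.of K) ⟶ pullback q (S.fromSpecResidueField s) := pullback.lift t g hg.symm
    have ht : t' ≫ pullback.fst _ _ = t := pullback.lift_fst _ _ _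
    have sq2 := (IsPullback.of_hasPullback (pullback.map p (S.fromSpecResidueField s) q
      (S.fromSpecResidueField s) r (𝟙 _) (𝟙 _) (by rw [← w]; simp) (by simp)) t').paste_horiz sq
    rw [ht] at sq2
    have h3 : IsClosedImmersion (pullback.snd (pullback.map p (S.fromSpecResidueField s) q
      (S.fromSpecResidueField s) r (𝟙 _) (𝟙 _) (by rw [← w]; simp) (by simp)) t') := inferInstance
    rw [← sq2.isoPullback_inv_snd]
    infer_instance
  have : LocallyQuasiFinite r := .of_fiberToSpecResidueField _ fun x ↦ by
    have : IsClosedImmersion (r.fiberToSpecResidueField x) :=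
      key (Q.residueField x) inferInstance _
    infer_instance
  have : IsFinite r := IsFinite.of_isProper_of_locallyQuasiFinite r
  exact finite_fiberwise r key
end

section
/- Let X be a noetherian integral locally factorial scheme, U ⊆ X a big open subscheme (complement of codimension ≥ 2), and L' a line bundle on U. Then L' extends to a line bundle L on X, and such an extension is unique up to unique isomorphism; moreover any homomorphism f' : L' → F|_U to the restriction of a locally free sheaf F on X extends uniquely to a homomorphism f : L → F. -/
open AlgebraicGeometry CategoryTheory Opposite TopologicalSpace

universe u

/-- A section `s` of a sheaf of modules over an open `U` trivializes it over `U`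
if multiplication by `s` identifies `O(V)` with `M(V)` for all opens `V ≤ U`. -/
def TrivializedBy {X : Scheme.{u}} (M : X.Modules) (U : X.Opens)
    (s : M.val.obj (op U)) : Prop :=
  ∀ (V : X.Opens) (h : V ≤ U),
    Function.Bijective (fun a : X.ringCatSheaf.val.obj (op V) =>
      a • (show M.val.obj (op V) from M.val.map (homOfLE h).op s))

/-- A sheaf of modules on a scheme is a line bundle if it is locally trivialized by a
single section. -/
def IsLineBundle {X : Scheme.{u}} (M : X.Modules) : Prop :=
  ∀ x : X, ∃ (U : X.Opens), x ∈ U ∧ ∃ s : M.val.obj (op U), TrivializedBy M U s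

/-- A sheaf of modules is locally free if it is locally trivialized by finitely many
sections. -/
def IsLocallyFree {X : Scheme.{u}} (F : X.Modules) : Prop :=
  ∀ x : X, ∃ (V : X.Opens), x ∈ V ∧ ∃ (n : ℕ) (s : Fin n → F.val.obj (op V)),
    ∀ (W : X.Opens) (h : W ≤ V),
      Function.Bijective (fun a : Fin n → X.ringCatSheaf.val.obj (op W) =>
        ∑ i, a i • (show F.val.obj (op W) from F.val.map (homOfLE h).op (s i)))

/-- The restriction of a presheaf of modules on `X` to the open subscheme `U ⊆ X`. -/
noncomputable def pullf {X : Scheme.{u}} (U : X.Opens) (M : X.PresheafOfModules) :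
    U.toScheme.PresheafOfModules :=
  (PresheafOfModules.pushforward₀ (U.ι.opensFunctor) X.ringCatSheaf.val).obj M

/-- The restriction of a morphism of presheaves of modules on `X` to `U ⊆ X`. -/
noncomputable def pullfMap {X : Scheme.{u}} (U : X.Opens) {M N : X.PresheafOfModules}
    (f : M ⟶ N) : pullf U M ⟶ pullf U N :=
  (PresheafOfModules.pushforward₀ (U.ι.opensFunctor) X.ringCatSheaf.val).map f

namespace BigOpen

/-- `h` is regular at `y`. -/
def Reg {X : Scheme.{u}} [IsIntegral X] (h : X.functionField) (y : X) : Prop :=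
  ∃ c : X.presheaf.stalk y, algebraMap (X.presheaf.stalk y) X.functionField c = h

section
variable {X : Scheme.{u}} [IsIntegral X]

lemma Reg.mul {h g : X.functionField} {y : X} (hh : Reg h y) (hg : Reg g y) : Reg (h * g) y := by
  obtain ⟨a, rfl⟩ := hh
  obtain ⟨b, rfl⟩ := hg
  exact ⟨a * b, map_mul _ _ _⟩

lemma Reg.one {y : X} : Reg (1 : X.functionField) y := ⟨1, map_one _⟩

/-- The rational function of a section, seen at `y`. -/
noncomputable def rat {W : X.Opens} (y : X) (hy : y ∈ W) (s : Γ(X, W)) : X.functionField :=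
  algebraMap (X.presheaf.stalk y) X.functionField (X.presheaf.germ W y hy s)

lemma rat_const {W : X.Opens} {y z : X} (hy : y ∈ W) (hz : z ∈ W) (s : Γ(X, W)) :
    rat y hy s = rat z hz s := by
  have : Nonempty W := ⟨⟨y, hy⟩⟩
  simp only [rat, Scheme.algebraMap_germ_eq_germToFunctionField]

lemma rat_res {W V : X.Opens} (i : V ⟶ W) {y : X} (hy : y ∈ V) (s : Γ(X, W)) :
    rat y hy (X.presheaf.map i.op s) = rat y (i.le hy) s := by
  simp only [rat, TopCat.Presheaf.germ_res_apply]

lemma rat_mul {W : X.Opens} {y : X} (hy : y ∈ W) (s t : Γ(X, W)) :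
    rat y hy (s * t) = rat y hy s * rat y hy t := by
  simp only [rat, map_mul]

lemma rat_one {W : X.Opens} {y : X} (hy : y ∈ W) :
    rat y hy (1 : Γ(X, W)) = 1 := by
  simp only [rat, map_one]

lemma sec_ext {W : X.Opens} {s t : Γ(X, W)} (H : ∀ y (hy : y ∈ W), rat y hy s = rat y hy t) :
    s = t := by
  apply TopCat.Presheaf.section_ext X.sheaf W
  intro y hy
  exact IsFractionRing.injective (X.presheaf.stalk y) X.functionField (H y hy)

lemma exists_section (W : X.Opens) (h : X.functionField) (H : ∀ y ∈ W, Reg h y) :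
    ∃ s : Γ(X, W), ∀ y (hy : y ∈ W), rat y hy s = h := by
  have H' : ∀ y : W, ∃ (V : X.Opens) (_ : V ≤ W) (hy : y.1 ∈ V) (s : Γ(X, V)),
      rat y.1 hy s = h := by
    rintro ⟨y, hy⟩
    obtain ⟨c, hc⟩ := H y hy
    obtain ⟨V, hV, s, rfl⟩ := X.presheaf.exists_germ_eq c
    refine ⟨V ⊓ W, inf_le_right, ⟨hV, hy⟩,
      X.presheaf.map (homOfLE inf_le_left).op s, ?_⟩
    exact (rat_res (homOfLE inf_le_left) _ s).trans hc
  choose V hVW hyV s hs using H'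
  obtain ⟨t, ht, -⟩ := X.sheaf.existsUnique_gluing' V W (fun y => homOfLE (hVW y))
    (fun y hy => Opens.mem_iSup.2 ⟨⟨y, hy⟩, hyV ⟨y, hy⟩⟩) s (by
      intro i j
      apply sec_ext
      intro y hy
      erw [rat_res, rat_res]
      rw [rat_const _ (hyV i), rat_const _ (hyV j), hs, hs])
  refine ⟨t, fun y hy => ?_⟩
  rw [← hs ⟨y, hy⟩, ← ht ⟨y, hy⟩]
  exact (rat_res (homOfLE (hVW ⟨y, hy⟩)) (hyV ⟨y, hy⟩) t).symm

/-- restatement of regularity in an affine chart -/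
lemma reg_iff_affine {V : X.Opens} (hV : IsAffineOpen V) [Nonempty V] (y : V)
    (h : X.functionField) :
    Reg h y.1 ↔ ∃ a b : Γ(X, V), b ∉ (hV.primeIdealOf y).asIdeal ∧
      h * algebraMap Γ(X, V) X.functionField b = algebraMap Γ(X, V) X.functionField a := by
  have := hV.isLocalization_stalk y
  let _hA := TopCat.Presheaf.algebra_section_stalk X.presheaf y
  have := functionField_isScalarTower X V y
  constructor
  · rintro ⟨c, rfl⟩
    obtain ⟨⟨a, b⟩, hab⟩ := IsLocalization.surj (hV.primeIdealOf y).asIdeal.primeCompl c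
    refine ⟨a, b, b.2, ?_⟩
    rw [IsScalarTower.algebraMap_apply Γ(X, V) (X.presheaf.stalk y.1) X.functionField,
      IsScalarTower.algebraMap_apply Γ(X, V) (X.presheaf.stalk y.1) X.functionField, ← map_mul]
    exact congrArg _ hab
  · rintro ⟨a, b, hb, hab⟩
    have hu : IsUnit (algebraMap Γ(X, V) (X.presheaf.stalk y.1) b) :=
      IsLocalization.map_units (M := (hV.primeIdealOf y).asIdeal.primeCompl) _ ⟨b, hb⟩
    obtain ⟨u, hu⟩ := hu
    refine ⟨algebraMap Γ(X, V) (X.presheaf.stalk y.1) a * ↑u⁻¹, ?_⟩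
    rw [map_mul, ← IsScalarTower.algebraMap_apply, ← hab,
      IsScalarTower.algebraMap_apply Γ(X, V) (X.presheaf.stalk y.1) X.functionField b, ← hu,
      mul_assoc, ← map_mul]
    simp

lemma specializes_iff_affine {V : X.Opens} (hV : IsAffineOpen V) (y z : V) :
    y.1 ⤳ z.1 ↔ (hV.primeIdealOf y).asIdeal ≤ (hV.primeIdealOf z).asIdeal := by
  rw [← hV.fromSpec_primeIdealOf y, ← hV.fromSpec_primeIdealOf z]
  exact (hV.fromSpec.isOpenEmbedding.isInducing.specializes_iff).trans
    (PrimeSpectrum.le_iff_specializes _ _).symm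

lemma exists_primeIdealOf {V : X.Opens} (hV : IsAffineOpen V) (P : Ideal Γ(X, V)) [hP : P.IsPrime] :
    ∃ y : V, (hV.primeIdealOf y).asIdeal = P := by
  have key : ∀ q : Spec Γ(X, V), hV.isoSpec.hom (hV.isoSpec.inv q) = q := by
    intro q
    rw [← Scheme.Hom.comp_apply, Iso.inv_hom_id]
    rfl
  exact ⟨hV.isoSpec.inv ⟨P, hP⟩, congrArg PrimeSpectrum.asIdeal (key ⟨P, hP⟩)⟩

lemma primeIdealOf_inj {V : X.Opens} (hV : IsAffineOpen V) (y z : V)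
    (h : (hV.primeIdealOf y).asIdeal = (hV.primeIdealOf z).asIdeal) : y = z := by
  apply Subtype.ext
  rw [← hV.fromSpec_primeIdealOf y, ← hV.fromSpec_primeIdealOf z]
  congr 1
  exact PrimeSpectrum.ext h


lemma Reg.exists_nhds {h : X.functionField} {x : X} (hx : Reg h x) :
    ∃ V : X.Opens, x ∈ V ∧ ∀ z ∈ V, Reg h z := by
  obtain ⟨c, rfl⟩ := hx
  obtain ⟨V, hV, s, rfl⟩ := X.presheaf.exists_germ_eq c
  refine ⟨V, hV, fun z hz => ⟨X.presheaf.germ V z hz s, ?_⟩⟩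
  exact rat_const hz hV s

lemma Reg.of_specializes {h : X.functionField} {x y : X} (hxy : y ⤳ x) (hx : Reg h x) :
    Reg h y := by
  obtain ⟨V, hxV, H⟩ := hx.exists_nhds
  exact H y (hxy.mem_open V.isOpen hxV)

lemma exists_affine (x : X) : ∃ V : X.Opens, IsAffineOpen V ∧ x ∈ V := by
  obtain ⟨V, hV, hx, -⟩ := X.isBasis_affineOpens.exists_subset_of_mem_open
    (Set.mem_univ x) isOpen_univ
  obtain ⟨V, hV', rfl⟩ := hV
  exact ⟨V, hV', hx⟩

/-- clearing denominators for a finitely generated ideal -/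
lemma exists_clear {R A : Type*} [CommRing R] [IsDomain R] [IsNoetherianRing R] [CommRing A]
    [Algebra R A] (Q : Ideal R) [Q.IsPrime] [IsLocalization.AtPrime A Q] (p : A) (a b : R)
    (hb : b ∉ Q) (hab : p * algebraMap R A b = algebraMap R A a) :
    ∃ t : R, t ∉ Q ∧ ∀ g : R, algebraMap R A g ∈ Ideal.span {p} → t * g ∈ Ideal.span {a} := by
  classical
  have hinj : Function.Injective (algebraMap R A) :=
    IsLocalization.injective A Q.primeCompl_le_nonZeroDivisors
  have H : ∀ g : R, ∃ t : R, t ∉ Q ∧ (algebraMap R A g ∈ Ideal.span {p} →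
      t * g ∈ Ideal.span {a}) := by
    intro g
    by_cases hg : algebraMap R A g ∈ Ideal.span {p}
    · obtain ⟨c, hc⟩ := Ideal.mem_span_singleton.1 hg
      obtain ⟨⟨c', b'⟩, hc'⟩ := IsLocalization.surj Q.primeCompl c
      refine ⟨b * b', fun h => ?_, fun _ => Ideal.mem_span_singleton.2 ⟨c', hinj ?_⟩⟩
      · exact (‹Q.IsPrime›.mem_or_mem h).elim hb b'.2
      · simp only [map_mul, hc, ← hab]
        dsimp only at hc'
        rw [← hc']
        ring
    · exact ⟨1, fun h => (Ideal.ne_top_iff_one Q).1 (Ideal.IsPrime.ne_top ‹_›) h,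
        fun h => (hg h).elim⟩
  choose t ht htg using H
  obtain ⟨S, hS⟩ := IsNoetherian.noetherian
    ((Ideal.span {p}).comap (algebraMap R A))
  refine ⟨∏ g ∈ S, t g, fun h => ?_, fun g hg => ?_⟩
  · obtain ⟨g, -, hg⟩ := (Ideal.IsPrime.prod_mem_iff).1 h
    exact ht g hg
  · have : (Ideal.span {p}).comap (algebraMap R A) ≤
        Submodule.comap (LinearMap.mulLeft R (∏ g ∈ S, t g)) (Ideal.span {a}) := by
      rw [← hS, Submodule.span_le]
      intro s hs
      have h1 : s ∈ (Ideal.span {p}).comap (algebraMap R A) := hS ▸ Submodule.subset_span hs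
      have h2 := htg s h1
      simp only [Submodule.comap_coe, Set.mem_preimage, LinearMap.mulLeft_apply, SetLike.mem_coe]
      rw [← Finset.prod_erase_mul S t hs, mul_assoc]
      exact Ideal.mul_mem_left _ _ h2
    exact this hg

lemma prime_point [IsLocallyNoetherian X] (x : X)
    [UniqueFactorizationMonoid (X.presheaf.stalk x)]
    (p : X.presheaf.stalk x) (hp : Prime p) :
    ∃ y : X, y ⤳ x ∧
      (∀ a : X.presheaf.stalk x, ¬ p ∣ a →
        Reg (algebraMap (X.presheaf.stalk x) X.functionField a)⁻¹ y) ∧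
      ¬ Reg (algebraMap (X.presheaf.stalk x) X.functionField p)⁻¹ y ∧
      (∃ V : X.Opens, x ∈ V ∧ ∀ z ∈ V, y ⤳ z ∨
        Reg (algebraMap (X.presheaf.stalk x) X.functionField p)⁻¹ z) ∧
      (∀ y₁ y₂ : X, y₁ ⤳ y → y₁ ≠ y → y₂ ⤳ y₁ → y₂ = y₁) := by
  obtain ⟨V, hV, hxV⟩ := exists_affine x
  have : Nonempty V := ⟨⟨x, hxV⟩⟩
  lift x to V using hxV
  have := hV.isLocalization_stalk x
  let _hA := TopCat.Presheaf.algebra_section_stalk X.presheaf x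
  have := functionField_isScalarTower X V x
  have := IsLocallyNoetherian.component_noetherian (X := X) ⟨V, hV⟩
  have : IsNoetherianRing Γ(X, V) := this
  have : IsFractionRing Γ(X, V) X.functionField := functionField_isFractionRing_of_isAffineOpen X V hV
  set Q := (hV.primeIdealOf x).asIdeal with hQ
  have hRA : ∀ r, algebraMap Γ(X, V) X.functionField r =
      algebraMap (X.presheaf.stalk x.1) X.functionField
        (algebraMap Γ(X, V) (X.presheaf.stalk x.1) r) := fun r =>
    IsScalarTower.algebraMap_apply _ _ _ r
  have hinjR : Function.Injective (algebraMap Γ(X, V) X.functionField) :=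
    IsFractionRing.injective _ _
  have hinjA : Function.Injective (algebraMap (X.presheaf.stalk x.1) X.functionField) :=
    IsFractionRing.injective _ _
  have hpp : (Ideal.span {p}).IsPrime := (Ideal.span_singleton_prime hp.ne_zero).2 hp
  obtain ⟨y, hy⟩ := exists_primeIdealOf hV
    ((Ideal.span {p}).comap (algebraMap Γ(X, V) (X.presheaf.stalk x.1)))
  have hmem : ∀ r, r ∈ (hV.primeIdealOf y).asIdeal ↔
      p ∣ algebraMap Γ(X, V) (X.presheaf.stalk x.1) r := by
    intro r
    rw [hy, Ideal.mem_comap, Ideal.mem_span_singleton]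
  have hunit : ∀ r, r ∉ Q → IsUnit (algebraMap Γ(X, V) (X.presheaf.stalk x.1) r) := fun r hr =>
    IsLocalization.map_units (M := Q.primeCompl) _ ⟨r, hr⟩
  have hPQ : (hV.primeIdealOf y).asIdeal ≤ Q := by
    intro r hr
    by_contra hrQ
    exact hp.not_unit (isUnit_of_dvd_unit ((hmem r).1 hr) (hunit r hrQ))
  obtain ⟨⟨a, b⟩, hab⟩ := IsLocalization.surj Q.primeCompl p
  have hbQ : (b : Γ(X, V)) ∉ Q := b.2
  have hbP : (b : Γ(X, V)) ∉ (hV.primeIdealOf y).asIdeal := fun h => hbQ (hPQ h)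
  have hp0 : algebraMap (X.presheaf.stalk x.1) X.functionField p ≠ 0 := by
    simpa using hinjA.ne hp.ne_zero
  have habK : algebraMap (X.presheaf.stalk x.1) X.functionField p *
      algebraMap Γ(X, V) X.functionField b = algebraMap Γ(X, V) X.functionField a := by
    rw [hRA, hRA, ← map_mul]; exact congrArg _ hab
  refine ⟨y.1, (specializes_iff_affine hV y x).2 hPQ, ?_, ?_, ?_, ?_⟩
  · intro c hc
    obtain ⟨⟨c', d⟩, hcd⟩ := IsLocalization.surj Q.primeCompl c
    refine (reg_iff_affine hV y _).2 ⟨d, c', fun h => ?_, ?_⟩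
    · have h1 := (hmem c').1 h
      rw [← hcd] at h1
      rcases hp.dvd_or_dvd h1 with h1 | h1
      · exact hc h1
      · exact hp.not_unit (isUnit_of_dvd_unit h1 (hunit d d.2))
    · have hc0 : algebraMap (X.presheaf.stalk x.1) X.functionField c ≠ 0 := by
        have : c ≠ 0 := by rintro rfl; exact hc (dvd_zero _)
        simpa using hinjA.ne this
      have hcdK : algebraMap (X.presheaf.stalk x.1) X.functionField c *
          algebraMap Γ(X, V) X.functionField d = algebraMap Γ(X, V) X.functionField c' := by
        rw [hRA, hRA, ← map_mul]; exact congrArg _ hcd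
      rw [← hcdK, inv_mul_cancel_left₀ hc0]
  · intro h
    obtain ⟨c, d, hd, hcd⟩ := (reg_iff_affine hV y _).1 h
    apply hd
    rw [hmem]
    refine ⟨algebraMap _ _ c, hinjA ?_⟩
    rw [map_mul, ← hRA, ← hRA, ← hcd, mul_inv_cancel_left₀ hp0]
  · obtain ⟨t, htQ, ht⟩ := exists_clear (A := X.presheaf.stalk x.1) Q p a b hbQ hab
    have ht0 : algebraMap Γ(X, V) X.functionField t ≠ 0 := by
      have : t ≠ 0 := by rintro rfl; exact htQ (zero_mem _)
      simpa using hinjR.ne this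
    have htx : Reg (algebraMap Γ(X, V) X.functionField t)⁻¹ x.1 :=
      (reg_iff_affine hV x _).2 ⟨1, t, htQ, by rw [inv_mul_cancel₀ ht0, map_one]⟩
    obtain ⟨V₁, hxV₁, hV₁⟩ := htx.exists_nhds
    refine ⟨V ⊓ V₁, ⟨x.2, hxV₁⟩, ?_⟩
    rintro z ⟨hzV, hzV₁⟩
    lift z to V using hzV
    have htz : t ∉ (hV.primeIdealOf z).asIdeal := by
      intro htz
      obtain ⟨c, d, hd, hcd⟩ := (reg_iff_affine hV z _).1 (hV₁ z.1 hzV₁)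
      apply hd
      have : d = t * c := hinjR (by rw [map_mul, ← hcd, mul_inv_cancel_left₀ ht0])
      rw [this]
      exact Ideal.mul_mem_right _ _ htz
    by_cases haz : a ∈ (hV.primeIdealOf z).asIdeal
    · left
      rw [specializes_iff_affine hV]
      intro g hg
      have h1 := ht g (by rw [Ideal.mem_span_singleton]; exact (hmem g).1 hg)
      have h2 := (Ideal.span_singleton_le_iff_mem _).2 haz h1
      exact ((hV.primeIdealOf z).isPrime.mem_or_mem h2).resolve_left htz
    · right
      refine (reg_iff_affine hV z _).2 ⟨b, a, haz, ?_⟩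
      rw [← habK, inv_mul_cancel_left₀ hp0]
  · intro y₁ y₂ h1 hne h2
    have hy1 : y₁ ∈ V := h1.mem_open V.isOpen y.2
    have hy2 : y₂ ∈ V := h2.mem_open V.isOpen hy1
    lift y₁ to V using hy1
    lift y₂ to V using hy2
    rw [specializes_iff_affine hV] at h1 h2
    by_contra hne2
    have hlt : ∃ c, c ∈ (hV.primeIdealOf y₁).asIdeal ∧ c ∉ (hV.primeIdealOf y₂).asIdeal := by
      by_contra! hcon
      exact hne2 (congrArg Subtype.val (primeIdealOf_inj hV y₂ y₁ (le_antisymm h2 hcon)))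
    obtain ⟨c, hc1, hc2⟩ := hlt
    have hc0 : c ≠ 0 := by rintro rfl; exact hc2 (zero_mem _)
    set P₁ := (hV.primeIdealOf y₁).asIdeal with hP1
    have hdisj : Disjoint (Q.primeCompl : Set Γ(X, V)) (P₁ : Set Γ(X, V)) := by
      rw [Set.disjoint_left]
      intro r hr hr'
      exact hr (hPQ (h1 hr'))
    have hP1A : (P₁.map (algebraMap Γ(X, V) (X.presheaf.stalk x.1))).IsPrime :=
      IsLocalization.isPrime_of_isPrime_disjoint Q.primeCompl _ P₁ (hV.primeIdealOf y₁).isPrime hdisj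
    have hcom : (P₁.map (algebraMap Γ(X, V) (X.presheaf.stalk x.1))).comap
        (algebraMap Γ(X, V) (X.presheaf.stalk x.1)) = P₁ :=
      IsLocalization.comap_map_of_isPrime_disjoint Q.primeCompl _ (hV.primeIdealOf y₁).isPrime hdisj
    have hne0 : P₁.map (algebraMap Γ(X, V) (X.presheaf.stalk x.1)) ≠ ⊥ := by
      intro h0
      have : algebraMap Γ(X, V) (X.presheaf.stalk x.1) c = 0 := by
        have := Ideal.mem_map_of_mem (algebraMap Γ(X, V) (X.presheaf.stalk x.1)) hc1
        rwa [h0, Ideal.mem_bot] at this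
      apply hc0
      apply hinjR
      rw [hRA, this, map_zero, map_zero]
    obtain ⟨q, hq, hqp⟩ := hP1A.exists_mem_prime_of_ne_bot hne0
    have hle : P₁.map (algebraMap Γ(X, V) (X.presheaf.stalk x.1)) ≤ Ideal.span {p} := by
      rw [Ideal.map_le_iff_le_comap, ← hy]; exact h1
    have hpq : p ∣ q := Ideal.mem_span_singleton.1 (hle hq)
    have hqp' : q ∣ p := (hp.associated_of_dvd hqp hpq).symm.dvd
    apply hne
    congr 1
    apply primeIdealOf_inj hV
    refine le_antisymm h1 ?_
    intro r hr
    rw [← hP1, ← hcom, Ideal.mem_comap]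
    exact Ideal.mem_of_dvd _ (hqp'.trans ((hmem r).1 hr)) hq


lemma hartogs_reg [IsLocallyNoetherian X]
    (hfact : ∀ x : X, UniqueFactorizationMonoid (X.presheaf.stalk x))
    (U : X.Opens)
    (hbig : ∀ z : X, z ∉ U →
      ∃ y₁ y₂ : X, y₂ ⤳ y₁ ∧ y₁ ⤳ z ∧ y₁ ≠ z ∧ y₂ ≠ y₁)
    (W : X.Opens) (h : X.functionField) (H : ∀ y ∈ W ⊓ U, Reg h y) :
    ∀ z ∈ W, Reg h z := by
  intro z hzW
  have := hfact z
  obtain ⟨a, b, hab, rfl⟩ := IsFractionRing.exists_reduced_fraction (A := X.presheaf.stalk z) h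
  rw [IsFractionRing.mk'_eq_div] at H ⊢
  by_cases hb : IsUnit (b : X.presheaf.stalk z)
  · obtain ⟨v, hv⟩ := hb
    refine ⟨a * ↑v⁻¹, ?_⟩
    rw [map_mul, ← hv, map_units_inv, div_eq_mul_inv]
  · have hb0 : (b : X.presheaf.stalk z) ≠ 0 := nonZeroDivisors.coe_ne_zero b
    obtain ⟨p, hpi, hpb⟩ := WfDvdMonoid.exists_irreducible_factor hb hb0
    have hp := hpi.prime
    obtain ⟨y, hyz, h1, h2, -, h4⟩ := prime_point z p hp
    have hyW : y ∈ W := hyz.mem_open W.isOpen hzW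
    have hyU : y ∈ U := by
      by_contra hyU
      obtain ⟨y₁, y₂, e1, e2, e3, e4⟩ := hbig y hyU
      exact e4 (h4 y₁ y₂ e2 e3 e1)
    have hpa : ¬ p ∣ a := fun hpa => hp.not_unit (hab hpa hpb)
    apply absurd _ h2
    obtain ⟨b', hb'⟩ := hpb
    have hinjA : Function.Injective (algebraMap (X.presheaf.stalk z) X.functionField) :=
      IsFractionRing.injective _ _
    have hne : ∀ c : X.presheaf.stalk z, c ≠ 0 →
      algebraMap (X.presheaf.stalk z) X.functionField c ≠ 0 := fun c hc => by
        simpa using hinjA.ne hc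
    have ha0 := hne a (by rintro rfl; exact hpa (dvd_zero _))
    have hp0 := hne p hp.ne_zero
    have hb'0 := hne b' (by rintro rfl; exact hb0 (by simpa using hb'))
    have e := ((H y ⟨hyW, hyU⟩).mul (h1 a hpa)).mul
      (Reg.of_specializes hyz ⟨b', rfl⟩)
    convert e using 1
    rw [hb', map_mul]
    field_simp

/-- `h` is an invertible function on `W` near `x`. -/
def NearUnit (x : X) (W : X.Opens) (h : X.functionField) : Prop :=
  ∃ V : X.Opens, x ∈ V ∧ ∀ z ∈ W ⊓ V, Reg h z ∧ Reg h⁻¹ z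

lemma NearUnit.mul {x : X} {W : X.Opens} {h g : X.functionField} (hh : NearUnit x W h)
    (hg : NearUnit x W g) : NearUnit x W (h * g) := by
  obtain ⟨V, hV, H⟩ := hh
  obtain ⟨V', hV', H'⟩ := hg
  refine ⟨V ⊓ V', ⟨hV, hV'⟩, fun z hz => ?_⟩
  have h1 := H z ⟨hz.1, hz.2.1⟩
  have h2 := H' z ⟨hz.1, hz.2.2⟩
  rw [mul_inv]
  exact ⟨h1.1.mul h2.1, h1.2.mul h2.2⟩

lemma NearUnit.inv {x : X} {W : X.Opens} {h : X.functionField} (hh : NearUnit x W h) :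
    NearUnit x W h⁻¹ := by
  obtain ⟨V, hV, H⟩ := hh
  exact ⟨V, hV, fun z hz => ⟨(H z hz).2, by rw [inv_inv]; exact (H z hz).1⟩⟩

lemma NearUnit.one {x : X} {W : X.Opens} : NearUnit x W 1 :=
  ⟨⊤, trivial, fun z _ => ⟨Reg.one, by rw [inv_one]; exact Reg.one⟩⟩

/-- `h` splits as a product of functions invertible on `W₁`, `W₂` near `x`. -/
def Splits' (x : X) (W₁ W₂ : X.Opens) (h : X.functionField) : Prop :=
  ∃ h₁ h₂ : X.functionField, h = h₁ * h₂ ∧ NearUnit x W₁ h₁ ∧ NearUnit x W₂ h₂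

lemma Splits'.mul {x : X} {W₁ W₂ : X.Opens} {h g : X.functionField} (hh : Splits' x W₁ W₂ h)
    (hg : Splits' x W₁ W₂ g) : Splits' x W₁ W₂ (h * g) := by
  obtain ⟨h1, h2, rfl, H1, H2⟩ := hh
  obtain ⟨g1, g2, rfl, G1, G2⟩ := hg
  exact ⟨h1 * g1, h2 * g2, by ring, H1.mul G1, H2.mul G2⟩

lemma Splits'.inv {x : X} {W₁ W₂ : X.Opens} {h : X.functionField} (hh : Splits' x W₁ W₂ h) :
    Splits' x W₁ W₂ h⁻¹ := by
  obtain ⟨h1, h2, rfl, H1, H2⟩ := hh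
  exact ⟨h1⁻¹, h2⁻¹, mul_inv _ _, H1.inv, H2.inv⟩

lemma splits_of_stalk [IsLocallyNoetherian X] (x : X)
    [UniqueFactorizationMonoid (X.presheaf.stalk x)] (W₁ W₂ : X.Opens)
    (a : X.presheaf.stalk x) (ha : a ≠ 0)
    (H : ∀ p, Prime p → p ∣ a → ∀ y : X, y ⤳ x →
      ¬ Reg (algebraMap (X.presheaf.stalk x) X.functionField p)⁻¹ y →
      (∀ a : X.presheaf.stalk x, ¬ p ∣ a →
        Reg (algebraMap (X.presheaf.stalk x) X.functionField a)⁻¹ y) → y ∉ W₁ ⊓ W₂) :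
    Splits' x W₁ W₂ (algebraMap (X.presheaf.stalk x) X.functionField a) := by
  induction a using UniqueFactorizationMonoid.induction_on_prime with
  | h₁ => exact absurd rfl ha
  | h₂ v hv =>
    obtain ⟨v, rfl⟩ := hv
    refine ⟨_, 1, (mul_one _).symm, ?_, NearUnit.one⟩
    obtain ⟨V, hV, H⟩ := Reg.exists_nhds
      (h := algebraMap (X.presheaf.stalk x) X.functionField v) (x := x) ⟨_, rfl⟩
    obtain ⟨V', hV', H'⟩ := Reg.exists_nhds
      (h := (algebraMap (X.presheaf.stalk x) X.functionField v)⁻¹) (x := x)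
        ⟨↑v⁻¹, by rw [map_units_inv]⟩
    exact ⟨V ⊓ V', ⟨hV, hV'⟩, fun z hz => ⟨H z hz.2.1, H' z hz.2.2⟩⟩
  | h₃ a p ha0 hp ih =>
    rw [map_mul]
    refine Splits'.mul ?_ (ih ha0 fun q hq hqa => H q hq (hqa.mul_left _))
    obtain ⟨y, hyx, h1, h2, ⟨V, hxV, hV⟩, -⟩ := prime_point x p hp
    have hy := H p hp (dvd_mul_right _ _) y hyx h2 h1
    obtain ⟨V', hV', H'⟩ := Reg.exists_nhds
      (h := algebraMap (X.presheaf.stalk x) X.functionField p) (x := x) ⟨_, rfl⟩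
    have key : ∀ W : X.Opens, y ∉ W →
        NearUnit x W (algebraMap (X.presheaf.stalk x) X.functionField p) := by
      intro W hyW
      refine ⟨V ⊓ V', ⟨hxV, hV'⟩, fun z hz => ⟨H' z hz.2.2, (hV z hz.2.1).resolve_left ?_⟩⟩
      exact fun hyz => hyW (hyz.mem_open W.isOpen hz.1)
    by_cases hy1 : y ∈ W₁
    · exact ⟨1, _, (one_mul _).symm, NearUnit.one, key _ fun hy2 => hy ⟨hy1, hy2⟩⟩
    · exact ⟨_, 1, (mul_one _).symm, key _ hy1, NearUnit.one⟩

lemma splits_of_unit [IsLocallyNoetherian X] (x : X)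
    [UniqueFactorizationMonoid (X.presheaf.stalk x)] (W₁ W₂ : X.Opens)
    (h : X.functionField) (h0 : h ≠ 0) (H : ∀ y ∈ W₁ ⊓ W₂, Reg h y ∧ Reg h⁻¹ y) :
    Splits' x W₁ W₂ h := by
  obtain ⟨a, b, hab, rfl⟩ := IsFractionRing.exists_reduced_fraction (A := X.presheaf.stalk x) h
  rw [IsFractionRing.mk'_eq_div] at H h0 ⊢
  have hb0 : (b : X.presheaf.stalk x) ≠ 0 := nonZeroDivisors.coe_ne_zero b
  have ha0 : a ≠ 0 := by rintro rfl; simp at h0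
  have hinjA : Function.Injective (algebraMap (X.presheaf.stalk x) X.functionField) :=
    IsFractionRing.injective _ _
  have hne : ∀ c : X.presheaf.stalk x, c ≠ 0 →
    algebraMap (X.presheaf.stalk x) X.functionField c ≠ 0 := fun c hc => by
      simpa using hinjA.ne hc
  have ha0' := hne _ ha0
  have hb0' := hne _ hb0
  rw [div_eq_mul_inv]
  refine Splits'.mul (splits_of_stalk x W₁ W₂ a ha0 ?_)
    (Splits'.inv (splits_of_stalk x W₁ W₂ b hb0 ?_))
  · intro p hp hpa y hyx h1 h2 hyW
    have e := (H y hyW).2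
    have hpb : ¬ p ∣ b := fun hpb => hp.not_unit (hab hpa hpb)
    apply h1
    obtain ⟨a', rfl⟩ := hpa
    have hp0 := hne p hp.ne_zero
    have ha'0 := hne a' (right_ne_zero_of_mul ha0)
    convert (e.mul (h2 b hpb)).mul (Reg.of_specializes hyx ⟨a', rfl⟩) using 1
    rw [map_mul]
    field_simp
  · intro p hp hpb y hyx h1 h2 hyW
    have e := (H y hyW).1
    have hpa : ¬ p ∣ a := fun hpa => hp.not_unit (hab hpa hpb)
    apply h1
    obtain ⟨b', hb'⟩ := hpb
    have hp0 := hne p hp.ne_zero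
    have hb'0 := hne b' (by rintro rfl; exact hb0 (by simpa using hb'))
    convert (e.mul (h2 a hpa)).mul (Reg.of_specializes hyx ⟨b', rfl⟩) using 1
    rw [hb', map_mul]
    field_simp

lemma exists_unit_section (W : X.Opens) (h : X.functionField)
    (H : ∀ y ∈ W, Reg h y ∧ Reg h⁻¹ y) (h0 : h ≠ 0) :
    ∃ s t : Γ(X, W), s * t = 1 ∧ ∀ y (hy : y ∈ W), rat y hy s = h := by
  obtain ⟨s, hs⟩ := exists_section W h (fun y hy => (H y hy).1)
  obtain ⟨t, ht⟩ := exists_section W h⁻¹ (fun y hy => (H y hy).2)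
  refine ⟨s, t, sec_ext fun y hy => ?_, hs⟩
  rw [rat_mul, hs, ht, rat_one, mul_inv_cancel₀ h0]

lemma split_unit [IsLocallyNoetherian X] (x : X)
    [UniqueFactorizationMonoid (X.presheaf.stalk x)] (W₁ W₂ W₁₂ : X.Opens)
    (hle : W₁ ⊓ W₂ ≤ W₁₂) 
    (u v : Γ(X, W₁₂)) (huv : u * v = 1) :
    ∃ V : X.Opens, x ∈ V ∧ ∃ (u₁ v₁ : Γ(X, W₁ ⊓ V)) (u₂ v₂ : Γ(X, W₂ ⊓ V)),
      u₁ * v₁ = 1 ∧ u₂ * v₂ = 1 ∧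
      ∀ (Z : X.Opens) (i₁ : Z ⟶ W₁ ⊓ V) (i₂ : Z ⟶ W₂ ⊓ V) (i : Z ⟶ W₁₂),
        X.presheaf.map i.op u = X.presheaf.map i₁.op u₁ * X.presheaf.map i₂.op u₂ := by
  by_cases hemp : ∃ y₀, y₀ ∈ W₁ ⊓ W₂
  · obtain ⟨y₀, hy₀⟩ := hemp
    have huv' : rat y₀ (hle hy₀) u * rat y₀ (hle hy₀) v = 1 := by rw [← rat_mul, huv, rat_one]
    have h0 : rat y₀ (hle hy₀) u ≠ 0 := left_ne_zero_of_mul_eq_one huv'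
    have hinv : (rat y₀ (hle hy₀) u)⁻¹ = rat y₀ (hle hy₀) v := inv_eq_of_mul_eq_one_right huv'
    obtain ⟨h₁, h₂, e, ⟨V₁, hxV₁, H₁⟩, ⟨V₂, hxV₂, H₂⟩⟩ := splits_of_unit x W₁ W₂
      (rat y₀ (hle hy₀) u) h0 (by
        intro y hy
        rw [hinv, rat_const (hle hy₀) (hle hy), rat_const (hle hy₀) (hle hy)]
        exact ⟨⟨_, rfl⟩, ⟨_, rfl⟩⟩)
    obtain ⟨u₁, v₁, e₁, hu₁⟩ := exists_unit_section (W₁ ⊓ (V₁ ⊓ V₂)) h₁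
      (fun y hy => H₁ y ⟨hy.1, hy.2.1⟩) (left_ne_zero_of_mul (e ▸ h0))
    obtain ⟨u₂, v₂, e₂, hu₂⟩ := exists_unit_section (W₂ ⊓ (V₁ ⊓ V₂)) h₂
      (fun y hy => H₂ y ⟨hy.1, hy.2.2⟩) (right_ne_zero_of_mul (e ▸ h0))
    refine ⟨V₁ ⊓ V₂, ⟨hxV₁, hxV₂⟩, u₁, v₁, u₂, v₂, e₁, e₂, ?_⟩
    intro Z i₁ i₂ i
    apply sec_ext
    intro y hy
    rw [rat_mul, rat_res, rat_res, rat_res, hu₁, hu₂, ← e]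
    exact rat_const _ _ u
  · refine ⟨⊤, trivial, 1, 1, 1, 1, one_mul _, one_mul _, ?_⟩
    intro Z i₁ i₂ i
    apply sec_ext
    intro y hy
    exact absurd ⟨y, (i₁.le hy).1, (i₂.le hy).1⟩ hemp

lemma hartogs_bij [IsLocallyNoetherian X]
    (hfact : ∀ x : X, UniqueFactorizationMonoid (X.presheaf.stalk x))
    (U : X.Opens)
    (hbig : ∀ z : X, z ∉ U →
      ∃ y₁ y₂ : X, y₂ ⤳ y₁ ∧ y₁ ⤳ z ∧ y₁ ≠ z ∧ y₂ ≠ y₁)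
    (W W' : X.Opens) (i : W' ⟶ W) (hle : W ⊓ U ≤ W') :
    Function.Bijective (X.presheaf.map i.op : Γ(X, W) → Γ(X, W')) := by
  have hgen : genericPoint X ∈ U := by
    by_contra hU
    obtain ⟨y₁, y₂, -, e2, e3, -⟩ := hbig _ hU
    exact e3 (e2.antisymm ((genericPoint_spec X).specializes trivial)).eq
  have hη : ∀ y ∈ W, genericPoint X ∈ W ⊓ U := fun y hy =>
    ⟨((genericPoint_spec X).specializes trivial).mem_open W.isOpen hy, hgen⟩
  constructor
  · intro s t hst
    apply sec_ext
    intro y hy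
    have h1 := hle (hη y hy)
    rw [rat_const hy (i.le h1), rat_const hy (i.le h1), ← rat_res i h1, ← rat_res i h1]
    exact congrArg _ hst
  · intro s
    by_cases hemp : ∃ y₀, y₀ ∈ W
    · obtain ⟨y₀, hy₀⟩ := hemp
      have h1 := hle (hη y₀ hy₀)
      obtain ⟨t, ht⟩ := exists_section W (rat _ h1 s) (hartogs_reg hfact U hbig W _ (by
        intro y hy
        rw [rat_const h1 (hle hy)]
        exact ⟨_, rfl⟩))
      refine ⟨t, sec_ext fun y hy => ?_⟩
      rw [rat_res, ht]
      exact rat_const _ _ s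
    · refine ⟨0, sec_ext fun y hy => ?_⟩
      exact absurd ⟨y, i.le hy⟩ hemp

end
end BigOpen


namespace BigOpen
section
variable {X : Scheme.{u}}

/-- restriction of functions -/
noncomputable def resO (X : Scheme.{u}) {U V : X.Opens} (h : V ≤ U) : Γ(X, U) →+* Γ(X, V) :=
  (X.presheaf.map (homOfLE h).op).hom

/-- restriction of sections -/
noncomputable def res (M : X.Modules) {U V : X.Opens} (h : V ≤ U) : Γ(M, U) →+ Γ(M, V) :=
  (M.presheaf.map (homOfLE h).op).hom

lemma resO_resO {U V W : X.Opens} (h : V ≤ U) (h' : W ≤ V) (a : Γ(X, U)) :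
    resO X h' (resO X h a) = resO X (h'.trans h) a := by
  have : (homOfLE (h'.trans h)).op = (homOfLE h).op ≫ (homOfLE h').op := rfl
  simp only [resO, this, X.presheaf.map_comp]
  rfl

lemma res_res (M : X.Modules) {U V W : X.Opens} (h : V ≤ U) (h' : W ≤ V) (a : Γ(M, U)) :
    res M h' (res M h a) = res M (h'.trans h) a := by
  have : (homOfLE (h'.trans h)).op = (homOfLE h).op ≫ (homOfLE h').op := rfl
  simp only [res, this, M.presheaf.map_comp]
  rfl

lemma res_smul (M : X.Modules) {U V : X.Opens} (h : V ≤ U) (a : Γ(X, U)) (s : Γ(M, U)) :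
    res M h (a • s) = resO X h a • res M h s :=
  Scheme.Modules.map_smul M (homOfLE h) a s

lemma resO_self {U : X.Opens} (a : Γ(X, U)) : resO X le_rfl a = a := by
  have : (homOfLE (le_refl U)).op = 𝟙 (op U) := rfl
  simp only [resO, this, X.presheaf.map_id]
  rfl

lemma res_self (M : X.Modules) {U : X.Opens} (a : Γ(M, U)) : res M le_rfl a = a := by
  have : (homOfLE (le_refl U)).op = 𝟙 (op U) := rfl
  simp only [res, this, M.presheaf.map_id]
  rfl

/-- Concrete sheaf property. -/
structure ShLike (P : X.Opens → Type u) (r : ∀ {U V : X.Opens}, V ≤ U → P U → P V) : Prop where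
  comp : ∀ {U V W : X.Opens} (h : V ≤ U) (h' : W ≤ V) (a : P U), r h' (r h a) = r (h'.trans h) a
  ext : ∀ {ι : Type u} (W : X.Opens) (V : ι → X.Opens) (hV : ∀ i, V i ≤ W)
    (_ : ∀ x ∈ W, ∃ i, x ∈ V i) (s t : P W), (∀ i, r (hV i) s = r (hV i) t) → s = t
  glue : ∀ {ι : Type u} (W : X.Opens) (V : ι → X.Opens) (hV : ∀ i, V i ≤ W)
    (_ : ∀ x ∈ W, ∃ i, x ∈ V i) (s : ∀ i, P (V i)),
    (∀ i j, r (inf_le_left : V i ⊓ V j ≤ V i) (s i) = r (inf_le_right : V i ⊓ V j ≤ V j) (s j)) →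
    ∃ t : P W, ∀ i, r (hV i) t = s i

lemma shLike_O : ShLike (X := X) (fun U => Γ(X, U)) (fun h => resO X h) where
  comp := resO_resO
  ext {ι} W V hV hc s t H := X.sheaf.eq_of_locally_eq' V W (fun i => homOfLE (hV i))
    (fun x hx => Opens.mem_iSup.2 (hc x hx)) s t H
  glue {ι} W V hV hc s H := by
    obtain ⟨t, ht, -⟩ := X.sheaf.existsUnique_gluing' V W (fun i => homOfLE (hV i))
      (fun x hx => Opens.mem_iSup.2 (hc x hx)) s H
    exact ⟨t, ht⟩

lemma shLike_M (M : X.Modules) : ShLike (X := X) (fun U => Γ(M, U)) (fun h => res M h) where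
  comp := res_res M
  ext {ι} W V hV hc s t H := TopCat.Sheaf.eq_of_locally_eq' (⟨M.presheaf, M.isSheaf⟩ : TopCat.Sheaf Ab X)
    V W (fun i => homOfLE (hV i)) (fun x hx => Opens.mem_iSup.2 (hc x hx)) s t H
  glue {ι} W V hV hc s H := by
    obtain ⟨t, ht, -⟩ := TopCat.Sheaf.existsUnique_gluing'
      (⟨M.presheaf, M.isSheaf⟩ : TopCat.Sheaf Ab X) V W (fun i => homOfLE (hV i))
      (fun x hx => Opens.mem_iSup.2 (hc x hx)) s H
    exact ⟨t, ht⟩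

lemma shLike_inf (M : X.Modules) (U : X.Opens) :
    ShLike (X := X) (fun W => Γ(M, W ⊓ U)) (fun h => res M (inf_le_inf_right U h)) where
  comp h h' a := res_res M _ _ _
  ext {ι} W V hV hc s t H := (shLike_M M).ext (W ⊓ U) (fun i => V i ⊓ U)
    (fun i => inf_le_inf_right U (hV i))
    (fun x hx => (hc x hx.1).imp fun i hi => ⟨hi, hx.2⟩) s t H
  glue {ι} W V hV hc s H := by
    refine (shLike_M M).glue (W ⊓ U) (fun i => V i ⊓ U)
      (fun i => inf_le_inf_right U (hV i))
      (fun x hx => (hc x hx.1).imp fun i hi => ⟨hi, hx.2⟩) s ?_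
    intro i j
    have hle : (V i ⊓ U) ⊓ (V j ⊓ U) ≤ (V i ⊓ V j) ⊓ U :=
      le_inf (inf_le_inf inf_le_left inf_le_left) (inf_le_left.trans inf_le_right)
    have := congrArg (res M hle) (H i j)
    rw [res_res, res_res] at this
    exact this

lemma ShLike.bij {P Q : X.Opens → Type u} {r : ∀ {U V : X.Opens}, V ≤ U → P U → P V}
    {q : ∀ {U V : X.Opens}, V ≤ U → Q U → Q V} (hP : ShLike P r) (hQ : ShLike Q q)
    (W : X.Opens) (φ : ∀ Z, Z ≤ W → P Z → Q Z)
    (nat : ∀ Z Z' (h : Z ≤ W) (h' : Z' ≤ Z) (a : P Z),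
      q h' (φ Z h a) = φ Z' (h'.trans h) (r h' a))
    (H : ∀ x ∈ W, ∃ V : X.Opens, x ∈ V ∧ ∀ Z (hZ : Z ≤ W), Z ≤ V → Function.Bijective (φ Z hZ)) :
    ∀ Z (hZ : Z ≤ W), Function.Bijective (φ Z hZ) := by
  intro Z hZ
  have H' : ∀ x : Z, ∃ V : X.Opens, x.1 ∈ V ∧ ∀ Z (hZ : Z ≤ W), Z ≤ V →
    Function.Bijective (φ Z hZ) := fun x => H x.1 (hZ x.2)
  choose V hxV hV using H'
  have hle : ∀ i, Z ⊓ V i ≤ Z := fun i => inf_le_left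
  have hcov : ∀ x ∈ Z, ∃ i, x ∈ Z ⊓ V i := fun x hx => ⟨⟨x, hx⟩, hx, hxV ⟨x, hx⟩⟩
  constructor
  · intro s t hst
    apply hP.ext Z (fun i => Z ⊓ V i) hle hcov
    intro i
    apply (hV i (Z ⊓ V i) ((hle i).trans hZ) inf_le_right).1
    rw [← nat _ _ hZ, ← nat _ _ hZ, hst]
  · intro m
    choose a ha using fun i => (hV i (Z ⊓ V i) ((hle i).trans hZ) inf_le_right).2 (q (hle i) m)
    obtain ⟨t, ht⟩ := hP.glue Z (fun i => Z ⊓ V i) hle hcov a (by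
      intro i j
      apply (hV i _ ((inf_le_left.trans (hle i)).trans hZ) (inf_le_left.trans inf_le_right)).1
      rw [← nat _ _ ((hle i).trans hZ), ← nat _ _ ((hle j).trans hZ), ha, ha, hQ.comp, hQ.comp])
    refine ⟨t, hQ.ext Z (fun i => Z ⊓ V i) hle hcov _ _ fun i => ?_⟩
    rw [nat, ht, ha]

/-- trivializing section -/
def Triv (M : X.Modules) (U : X.Opens) (s : Γ(M, U)) : Prop :=
  ∀ (V : X.Opens) (h : V ≤ U), Function.Bijective (fun a : Γ(X, V) => a • res M h s)

lemma triv_iff (M : X.Modules) (U : X.Opens) (s : Γ(M, U)) :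
    TrivializedBy M U s ↔ Triv M U s := Iff.rfl

lemma Triv.res {M : X.Modules} {U V : X.Opens} {s : Γ(M, U)} (hs : Triv M U s) (h : V ≤ U) :
    Triv M V (res M h s) := by
  intro W hW
  simp only [res_res]
  exact hs W _

lemma Triv.unit_smul {M : X.Modules} {U : X.Opens} {s : Γ(M, U)} (hs : Triv M U s)
    (u v : Γ(X, U)) (huv : u * v = 1) : Triv M U (u • s) := by
  intro W hW
  have : (fun a : Γ(X, W) => a • BigOpen.res M hW (u • s)) =
      (fun a : Γ(X, W) => a • BigOpen.res M hW s) ∘ (fun a => a * resO X hW u) := by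
    funext a
    simp only [Function.comp, res_smul, mul_smul]
  rw [this]
  refine (hs W hW).comp ?_
  have huv' : resO X hW u * resO X hW v = 1 := by rw [← map_mul, huv, map_one]
  exact (Units.mulRight_bijective (⟨_, _, huv', by rw [mul_comm, huv']⟩ : (Γ(X, W))ˣ))

lemma triv_of_local {M : X.Modules} {U : X.Opens} {s : Γ(M, U)}
    (H : ∀ x ∈ U, ∃ (V : X.Opens) (h : V ≤ U), x ∈ V ∧ Triv M V (res M h s)) : Triv M U s := by
  refine ShLike.bij shLike_O (shLike_M M) U (fun Z hZ a => a • res M hZ s) ?_ ?_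
  · intro Z Z' h h' a
    rw [res_smul, res_res]
  · intro x hx
    obtain ⟨V, h, hxV, hV⟩ := H x hx
    refine ⟨V, hxV, fun Z hZ hZV => ?_⟩
    have := hV Z hZV
    simp only [res_res] at this
    exact this

lemma glue2 (M : X.Modules) (A B W : X.Opens) (hA : A ≤ W) (hB : B ≤ W)
    (hW : ∀ x ∈ W, x ∈ A ∨ x ∈ B) (s : Γ(M, A)) (t : Γ(M, B))
    (hst : res M (inf_le_left : A ⊓ B ≤ A) s = res M (inf_le_right : A ⊓ B ≤ B) t) :
    ∃ r : Γ(M, W), res M hA r = s ∧ res M hB r = t := by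
  obtain ⟨r, hr⟩ := (shLike_M M).glue (ι := ULift Bool) W
    (fun b => match b with | ⟨true⟩ => A | ⟨false⟩ => B)
    (fun b => match b with | ⟨true⟩ => hA | ⟨false⟩ => hB)
    (fun x hx => (hW x hx).elim (fun h => ⟨⟨true⟩, h⟩) (fun h => ⟨⟨false⟩, h⟩))
    (fun b => match b with | ⟨true⟩ => s | ⟨false⟩ => t) (by
      rintro ⟨_ | _⟩ ⟨_ | _⟩
      · rfl
      · have hle : B ⊓ A ≤ A ⊓ B := le_inf inf_le_right inf_le_left
        have := congrArg (res M hle) hst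
        rw [res_res, res_res] at this
        exact this.symm
      · exact hst
      · rfl)
  exact ⟨r, hr ⟨true⟩, hr ⟨false⟩⟩

lemma triv_step [IsIntegral X] [IsLocallyNoetherian X] (M : X.Modules) (x : X)
    [UniqueFactorizationMonoid (X.presheaf.stalk x)] (A B : X.Opens) (s : Γ(M, A)) (t : Γ(M, B))
    (hs : Triv M A s) (ht : Triv M B t) :
    ∃ V : X.Opens, x ∈ V ∧ ∃ r : Γ(M, (A ⊔ B) ⊓ V), Triv M ((A ⊔ B) ⊓ V) r := by
  obtain ⟨u, hu⟩ := (ht (A ⊓ B) inf_le_right).2 (res M inf_le_left s)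
  obtain ⟨v, hv⟩ := (hs (A ⊓ B) inf_le_left).2 (res M inf_le_right t)
  dsimp only at hu hv
  have huv : u * v = 1 := by
    apply (hs (A ⊓ B) inf_le_left).1
    dsimp only
    rw [mul_smul, hv, hu, one_smul]
  obtain ⟨V, hxV, u₁, v₁, u₂, v₂, e₁, e₂, H⟩ := split_unit x A B (A ⊓ B) le_rfl u v huv
  refine ⟨V, hxV, ?_⟩
  have hs' := (hs.res (inf_le_left : A ⊓ V ≤ A)).unit_smul v₁ u₁ (by rw [mul_comm, e₁])
  have ht' := (ht.res (inf_le_left : B ⊓ V ≤ B)).unit_smul u₂ v₂ e₂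
  obtain ⟨r, hr1, hr2⟩ := glue2 M (A ⊓ V) (B ⊓ V) ((A ⊔ B) ⊓ V)
    (inf_le_inf_right _ le_sup_left) (inf_le_inf_right _ le_sup_right)
    (by
      rintro y ⟨hy | hy, hyV⟩
      · exact Or.inl ⟨hy, hyV⟩
      · exact Or.inr ⟨hy, hyV⟩) (v₁ • res M inf_le_left s) (u₂ • res M inf_le_left t) (by
      have hZ : (A ⊓ V) ⊓ (B ⊓ V) ≤ A ⊓ B := inf_le_inf inf_le_left inf_le_left
      have h1 := H ((A ⊓ V) ⊓ (B ⊓ V)) (homOfLE inf_le_left) (homOfLE inf_le_right) (homOfLE hZ)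
      change resO X _ u = resO X _ u₁ * resO X _ u₂ at h1
      have h2 := congrArg (res M hZ) hu
      rw [res_smul, res_res, res_res, h1] at h2
      rw [res_smul, res_smul, res_res, res_res, ← h2, smul_smul, ← mul_assoc, ← map_mul,
        mul_comm v₁, e₁, map_one, one_mul])
  refine ⟨r, triv_of_local ?_⟩
  rintro y ⟨hy | hy, hyV⟩
  · exact ⟨A ⊓ V, inf_le_inf_right _ le_sup_left, ⟨hy, hyV⟩, hr1 ▸ hs'⟩
  · exact ⟨B ⊓ V, inf_le_inf_right _ le_sup_right, ⟨hy, hyV⟩, hr2 ▸ ht'⟩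

lemma triv_near [IsIntegral X] [IsNoetherian X] (M : X.Modules) (x : X)
    [UniqueFactorizationMonoid (X.presheaf.stalk x)] (U : X.Opens)
    (hM : ∀ y ∈ U, ∃ (V : X.Opens) (s : Γ(M, V)), y ∈ V ∧ Triv M V s) :
    ∃ V : X.Opens, x ∈ V ∧ ∃ r : Γ(M, V ⊓ U), Triv M (V ⊓ U) r := by
  have hc : IsCompact (U : Set X) := NoetherianSpace.isCompact _
  have key : ∃ W : X.Opens, (U : Set X) ⊆ W ∧ ∃ V : X.Opens, x ∈ V ∧
      ∃ r : Γ(M, W ⊓ V), Triv M (W ⊓ V) r := by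
    refine hc.induction_on (p := fun S => ∃ W : X.Opens, S ⊆ W ∧ ∃ V : X.Opens, x ∈ V ∧
      ∃ r : Γ(M, W ⊓ V), Triv M (W ⊓ V) r) ?_ ?_ ?_ ?_
    · refine ⟨⊥, Set.empty_subset _, ⊤, trivial, 0, triv_of_local ?_⟩
      rintro y ⟨hy, -⟩
      exact hy.elim
    · rintro S T hST ⟨W, hW, h⟩
      exact ⟨W, hST.trans hW, h⟩
    · rintro S T ⟨W₁, hW₁, V₁, hx₁, r₁, h₁⟩ ⟨W₂, hW₂, V₂, hx₂, r₂, h₂⟩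
      obtain ⟨V, hxV, r, hr⟩ := triv_step M x _ _ r₁ r₂ h₁ h₂
      refine ⟨W₁ ⊔ W₂, ?_, V₁ ⊓ V₂ ⊓ V, ⟨⟨hx₁, hx₂⟩, hxV⟩, ?_⟩
      · rw [Opens.coe_sup]
        exact Set.union_subset_union hW₁ hW₂
      · have hle : (W₁ ⊔ W₂) ⊓ (V₁ ⊓ V₂ ⊓ V) ≤ (W₁ ⊓ V₁ ⊔ W₂ ⊓ V₂) ⊓ V := by
          rintro y ⟨hy | hy, ⟨h1, h2⟩, h3⟩
          · exact ⟨Or.inl ⟨hy, h1⟩, h3⟩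
          · exact ⟨Or.inr ⟨hy, h2⟩, h3⟩
        exact ⟨_, hr.res hle⟩
    · intro y hy
      obtain ⟨V, s, hyV, hs⟩ := hM y hy
      exact ⟨V, mem_nhdsWithin_of_mem_nhds (V.isOpen.mem_nhds hyV), V, subset_rfl, ⊤, trivial,
        _, hs.res inf_le_left⟩
  obtain ⟨W, hUW, V, hxV, r, hr⟩ := key
  have hle : V ⊓ U ≤ W ⊓ V := fun y hy => ⟨hUW hy.2, hy.1⟩
  exact ⟨V, hxV, _, hr.res hle⟩

/-- Hartogs for locally free sheaves. -/
lemma hartogs_free [IsIntegral X] [IsLocallyNoetherian X]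
    (hfact : ∀ x : X, UniqueFactorizationMonoid (X.presheaf.stalk x))
    (U : X.Opens)
    (hbig : ∀ z : X, z ∉ U →
      ∃ y₁ y₂ : X, y₂ ⤳ y₁ ∧ y₁ ⤳ z ∧ y₁ ≠ z ∧ y₂ ≠ y₁)
    (F : X.Modules) (hF : IsLocallyFree F) (W : X.Opens) :
    Function.Bijective (res F (inf_le_left : W ⊓ U ≤ W)) := by
  refine ShLike.bij (shLike_M F) (shLike_inf F U) ⊤
    (fun Z _ => res F (inf_le_left : Z ⊓ U ≤ Z)) ?_ ?_ W le_top
  · intro Z Z' h h' a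
    rw [res_res, res_res]
  · intro x _
    obtain ⟨V, hxV, n, s, hs⟩ := hF x
    refine ⟨V, hxV, fun Z _ hZV => ?_⟩
    have hs' : ∀ (W : X.Opens) (h : W ≤ V), Function.Bijective
      (fun a : Fin n → Γ(X, W) => ∑ i, a i • res F h (s i)) := hs
    have hO : Function.Bijective (fun (a : Fin n → Γ(X, Z)) i =>
        resO X (inf_le_left : Z ⊓ U ≤ Z) (a i)) :=
      Function.Bijective.piMap (fun _ => hartogs_bij hfact U hbig Z (Z ⊓ U) (homOfLE inf_le_left) le_rfl)
    have h1 := hs' Z hZV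
    have h2 := (hs' (Z ⊓ U) (inf_le_left.trans hZV)).comp hO
    rw [← Function.Bijective.of_comp_iff _ h1]
    convert h2 using 1
    funext a
    simp only [Function.comp, map_sum, res_smul]
    exact Finset.sum_congr rfl fun i _ => congrArg _ (res_res F _ _ _)

end
end BigOpen

namespace BigOpen
section
variable {X : Scheme.{u}}

lemma img_le (U W : X.Opens) : U.ι ''ᵁ (U.ι ⁻¹ᵁ W) ≤ W := U.ι.image_preimage_le W

lemma img_eq (U W : X.Opens) : U.ι ''ᵁ (U.ι ⁻¹ᵁ W) = W ⊓ U := by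
  ext x
  constructor
  · rintro ⟨y, hy, rfl⟩
    exact ⟨hy, y.2⟩
  · rintro ⟨h1, h2⟩
    exact ⟨⟨x, h2⟩, h1, rfl⟩

lemma hartogs_img [IsIntegral X] [IsLocallyNoetherian X]
    (hfact : ∀ x : X, UniqueFactorizationMonoid (X.presheaf.stalk x))
    (U : X.Opens)
    (hbig : ∀ z : X, z ∉ U →
      ∃ y₁ y₂ : X, y₂ ⤳ y₁ ∧ y₁ ⤳ z ∧ y₁ ≠ z ∧ y₂ ≠ y₁)
    (F : X.Modules) (hF : IsLocallyFree F) (W : X.Opens) :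
    Function.Bijective (res F (img_le U W)) := by
  have key : ∀ (W' : X.Opens) (_ : W' = W ⊓ U) (h : W' ≤ W), Function.Bijective (res F h) := by
    rintro _ rfl h
    exact hartogs_free hfact U hbig F hF W
  exact key _ (img_eq U W) _

/-- sections map of a morphism between restrictions -/
noncomputable def gapp {U : X.Opens} {L F : X.Modules} (g : pullf U L.val ⟶ pullf U F.val)
    (V : U.toScheme.Opens) : Γ(L, U.ι ''ᵁ V) →+ Γ(F, U.ι ''ᵁ V) :=
  (g.app (op V)).hom.toAddMonoidHom

lemma gapp_smul {U : X.Opens} {L F : X.Modules} (g : pullf U L.val ⟶ pullf U F.val)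
    (V : U.toScheme.Opens) (r : Γ(X, U.ι ''ᵁ V)) (s : Γ(L, U.ι ''ᵁ V)) :
    gapp g V (r • s) = r • gapp g V s :=
  (g.app (op V)).hom.map_smul r s

lemma gapp_res {U : X.Opens} {L F : X.Modules} (g : pullf U L.val ⟶ pullf U F.val)
    (V V' : U.toScheme.Opens) (h : V' ≤ V) (s : Γ(L, U.ι ''ᵁ V)) :
    gapp g V' (res L (U.ι.image_mono h) s) = res F (U.ι.image_mono h) (gapp g V s) :=
  PresheafOfModules.naturality_apply g (homOfLE h).op s

lemma app_res {L F : X.Modules} (f : L ⟶ F) {W W' : X.Opens} (h : W' ≤ W) (s : Γ(L, W)) :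
    f.app W' (res L h s) = res F h (f.app W s) :=
  PresheafOfModules.naturality_apply f.val (homOfLE h).op s

lemma gapp_pullf {U : X.Opens} {L F : X.Modules} (f : L ⟶ F) (V : U.toScheme.Opens)
    (s : Γ(L, U.ι ''ᵁ V)) : gapp (pullfMap U f.val) V s = f.app _ s := rfl

lemma gapp_ext {U : X.Opens} {L F : X.Modules} {g g' : pullf U L.val ⟶ pullf U F.val}
    (h : ∀ V s, gapp g V s = gapp g' V s) : g = g' := by
  apply PresheafOfModules.hom_ext
  intro V
  apply ModuleCat.hom_ext
  apply LinearMap.ext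
  intro s
  exact h V.unop s

/-- Build a morphism from its values on sections. -/
lemma exists_hom {L F : X.Modules} (φ : ∀ W : X.Opens, Γ(L, W) → Γ(F, W))
    (hadd : ∀ W s t, φ W (s + t) = φ W s + φ W t)
    (hsmul : ∀ W (r : Γ(X, W)) s, φ W (r • s) = r • φ W s)
    (hres : ∀ (W W' : X.Opens) (h : W' ≤ W) s, φ W' (res L h s) = res F h (φ W s)) :
    ∃ f : L ⟶ F, ∀ W s, f.app W s = φ W s := by
  let p : L.val.presheaf ⟶ F.val.presheaf :=
    { app := fun W => AddCommGrpCat.ofHom (AddMonoidHom.mk' (φ W.unop) (hadd W.unop))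
      naturality := by
        intro W W' i
        apply AddCommGrpCat.hom_ext
        apply AddMonoidHom.ext
        intro s
        exact hres W.unop W'.unop (leOfHom i.unop) s }
  let f : L ⟶ F := ⟨PresheafOfModules.homMk p (fun W r m => hsmul W.unop r m)⟩
  exact ⟨f, fun W s => rfl⟩

theorem ext_hom [IsIntegral X] [IsLocallyNoetherian X]
    (hfact : ∀ x : X, UniqueFactorizationMonoid (X.presheaf.stalk x))
    (U : X.Opens)
    (hbig : ∀ z : X, z ∉ U →
      ∃ y₁ y₂ : X, y₂ ⤳ y₁ ∧ y₁ ⤳ z ∧ y₁ ≠ z ∧ y₂ ≠ y₁)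
    (L F : X.Modules) (hF : IsLocallyFree F) (g : pullf U L.val ⟶ pullf U F.val) :
    ∃! f : L ⟶ F, pullfMap U f.val = g := by
  have bF := hartogs_img hfact U hbig F hF
  choose φ hφ using fun (W : X.Opens) (s : Γ(L, W)) =>
    (bF W).2 (gapp g (U.ι ⁻¹ᵁ W) (res L (img_le U W) s))
  have hres : ∀ (W W' : X.Opens) (h : W' ≤ W) s, φ W' (res L h s) = res F h (φ W s) := by
    intro W W' h s
    apply (bF W').1
    rw [hφ, res_res, res_res]
    have hle : U.ι ⁻¹ᵁ W' ≤ U.ι ⁻¹ᵁ W := fun x hx => h hx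
    rw [← res_res F (img_le U W) (U.ι.image_mono hle), hφ, ← gapp_res g _ _ hle, res_res]
  obtain ⟨f, hf⟩ := exists_hom φ
    (fun W s t => (bF W).1 (by rw [hφ, map_add, map_add, map_add, hφ, hφ]))
    (fun W r s => (bF W).1 (by rw [hφ, res_smul, res_smul, gapp_smul, hφ])) hres
  refine ⟨f, gapp_ext fun V s => ?_, fun f' hf' => ?_⟩
  · rw [gapp_pullf, hf]
    apply (bF _).1
    rw [hφ]
    exact gapp_res g V _ (U.ι.preimage_image_eq V).le s
  · apply Scheme.Modules.hom_ext
    intro W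
    apply AddCommGrpCat.hom_ext
    apply AddMonoidHom.ext
    intro s
    refine Eq.trans ?_ (hf W s).symm
    apply (bF _).1
    rw [hφ, ← hf', gapp_pullf]
    exact (app_res f' _ s).symm

lemma IsLineBundle.isLocallyFree {L : X.Modules} (h : IsLineBundle L) : IsLocallyFree L := by
  intro x
  obtain ⟨V, hx, s, hs⟩ := h x
  refine ⟨V, hx, 1, fun _ => s, fun W hW => ?_⟩
  have h1 := (hs W hW).comp (Equiv.funUnique (Fin 1) (X.ringCatSheaf.val.obj (op W))).bijective
  convert h1 using 1
  funext a
  simp [Function.comp]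

lemma pullfMap_comp {U : X.Opens} {L F G : X.Modules} (f : L ⟶ F) (g : F ⟶ G) :
    pullfMap U (f ≫ g).val = pullfMap U f.val ≫ pullfMap U g.val := rfl

lemma pullfMap_id {U : X.Opens} (L : X.Modules) :
    pullfMap U (𝟙 L : L ⟶ L).val = 𝟙 _ := rfl

theorem unique_iso [IsIntegral X] [IsLocallyNoetherian X]
    (hfact : ∀ x : X, UniqueFactorizationMonoid (X.presheaf.stalk x))
    (U : X.Opens)
    (hbig : ∀ z : X, z ∉ U →
      ∃ y₁ y₂ : X, y₂ ⤳ y₁ ∧ y₁ ⤳ z ∧ y₁ ≠ z ∧ y₂ ≠ y₁)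
    (L₁ L₂ : X.Modules) (h₁ : IsLineBundle L₁) (h₂ : IsLineBundle L₂)
    (e : pullf U L₁.val ≅ pullf U L₂.val) :
    ∃! ψ : L₁ ⟶ L₂, IsIso ψ ∧ pullfMap U ψ.val = e.hom := by
  have F₁ := IsLineBundle.isLocallyFree h₁
  have F₂ := IsLineBundle.isLocallyFree h₂
  obtain ⟨f, hf, hfu⟩ := ext_hom hfact U hbig L₁ L₂ F₂ e.hom
  obtain ⟨g, hg, -⟩ := ext_hom hfact U hbig L₂ L₁ F₁ e.inv
  have hfg : f ≫ g = 𝟙 _ := (ext_hom hfact U hbig L₁ L₁ F₁ (𝟙 _)).unique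
    (by rw [pullfMap_comp, hf, hg, e.hom_inv_id]) (pullfMap_id _)
  have hgf : g ≫ f = 𝟙 _ := (ext_hom hfact U hbig L₂ L₂ F₂ (𝟙 _)).unique
    (by rw [pullfMap_comp, hf, hg, e.inv_hom_id]) (pullfMap_id _)
  exact ⟨f, ⟨⟨g, hfg, hgf⟩, hf⟩, fun y hy => hfu y hy.2⟩

end
end BigOpen

namespace BigOpen
section
variable {X : Scheme.{u}}

/-- the pushforward -/
noncomputable abbrev pf (U : X.Opens) (L' : U.toScheme.Modules) : X.Modules :=
  (Scheme.Modules.pushforward U.ι).obj L'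

lemma pf_smul (U : X.Opens) (L' : U.toScheme.Modules) (W : X.Opens) (r : Γ(X, W))
    (s : Γ(L', U.ι ⁻¹ᵁ W)) :
    (show Γ(pf U L', W) from r • (show Γ(pf U L', W) from s)) = (U.ι.app W r) • s := rfl

lemma pf_res (U : X.Opens) (L' : U.toScheme.Modules) {W W' : X.Opens} (h : W' ≤ W)
    (s : Γ(L', U.ι ⁻¹ᵁ W)) :
    res (pf U L') h s = res L' (show U.ι ⁻¹ᵁ W' ≤ U.ι ⁻¹ᵁ W from fun _ hx => h hx) s := rfl

lemma res_bij_of_eq (M : X.Modules) {W W' : X.Opens} (h : W' ≤ W) (h' : W' = W) :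
    Function.Bijective (res M h) := by
  subst h'
  have : (res M h : Γ(M, W') → Γ(M, W')) = id := by
    funext a
    exact res_self M a
  rw [this]
  exact Function.bijective_id

lemma app_bij (U W : X.Opens) (h : W ≤ U) : Function.Bijective (U.ι.app W) := by
  have : IsIso (U.ι.app W) := U.ι.isIso_app W (by rw [Scheme.Opens.opensRange_ι]; exact h)
  exact ConcreteCategory.bijective_of_isIso _

lemma pf_triv_in (U : X.Opens) (L' : U.toScheme.Modules) (W' : U.toScheme.Opens) (s : Γ(L', W'))
    (hs : Triv L' W' s) : ∃ s' : Γ(pf U L', U.ι ''ᵁ W'), Triv (pf U L') (U.ι ''ᵁ W') s' := by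
  have hle : U.ι ⁻¹ᵁ (U.ι ''ᵁ W') ≤ W' := (U.ι.preimage_image_eq W').le
  refine ⟨res L' hle s, fun Z hZ => ?_⟩
  have hZ' : U.ι ⁻¹ᵁ Z ≤ W' := le_trans (fun _ hx => hZ hx) hle
  have h1 := (hs (U.ι ⁻¹ᵁ Z) hZ').comp (app_bij U Z (hZ.trans (by
    rintro _ ⟨y, -, rfl⟩
    exact y.2)))
  have h2 : res (pf U L') hZ (res L' hle s) = res L' hZ' s := by
    rw [pf_res]
    exact res_res L' _ _ _
  rw [h2]
  exact h1

lemma pf_inf_bij (U : X.Opens) (L' : U.toScheme.Modules) (W : X.Opens) :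
    Function.Bijective (res (pf U L') (inf_le_left : W ⊓ U ≤ W)) := by
  have h : U.ι ⁻¹ᵁ (W ⊓ U) = U.ι ⁻¹ᵁ W := by
    ext x
    exact ⟨fun h => h.1, fun h => ⟨h, x.2⟩⟩
  exact res_bij_of_eq L' h.le h

theorem pf_lineBundle [IsIntegral X] [IsNoetherian X]
    (hfact : ∀ x : X, UniqueFactorizationMonoid (X.presheaf.stalk x))
    (U : X.Opens)
    (hbig : ∀ z : X, z ∉ U →
      ∃ y₁ y₂ : X, y₂ ⤳ y₁ ∧ y₁ ⤳ z ∧ y₁ ≠ z ∧ y₂ ≠ y₁)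
    (L' : U.toScheme.Modules) (hL' : IsLineBundle L') : IsLineBundle (pf U L') := by
  intro x
  have := hfact x
  obtain ⟨V, hxV, r, hr⟩ := triv_near (pf U L') x U (by
    intro y hy
    obtain ⟨W', hW', s, hs⟩ := hL' ⟨y, hy⟩
    obtain ⟨s', hs'⟩ := pf_triv_in U L' W' s hs
    exact ⟨_, s', ⟨⟨y, hy⟩, hW', rfl⟩, hs'⟩)
  obtain ⟨s, hs⟩ := (pf_inf_bij U L' V).2 r
  refine ⟨V, hxV, s, (triv_iff _ _ _).2 fun Z hZ => ?_⟩
  have h1 := (hr (Z ⊓ U) (inf_le_inf_right U hZ)).comp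
    (hartogs_bij hfact U hbig Z (Z ⊓ U) (homOfLE inf_le_left) le_rfl)
  rw [← Function.Bijective.of_comp_iff' (pf_inf_bij U L' Z)]
  convert h1 using 1
  funext a
  simp only [Function.comp]
  rw [res_smul, ← hs, res_res, res_res]
  rfl

/-- counit on presheaves of groups -/
theorem pf_iso (U : X.Opens) (L' : U.toScheme.Modules) :
    Nonempty (pullf U (pf U L').val ≅ L'.val) := by
  let p : (pullf U (pf U L').val).presheaf ⟶ L'.val.presheaf :=
    { app := fun W => L'.presheaf.map (eqToHom (U.ι.preimage_image_eq W.unop).symm).op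
      naturality := by
        intro W W' i
        change L'.presheaf.map _ ≫ L'.presheaf.map _ = L'.presheaf.map _ ≫ L'.presheaf.map _
        rw [← L'.presheaf.map_comp, ← L'.presheaf.map_comp]
        rfl }
  let q : pullf U (pf U L').val ⟶ L'.val := PresheafOfModules.homMk p (by
    intro W r m
    have h1 := L'.map_smul (eqToHom (U.ι.preimage_image_eq W.unop).symm) (U.ι.app _ r) m
    refine h1.trans ?_
    refine congrArg (fun t : Γ(U.toScheme, W.unop) => t •
      (show Γ(L', W.unop) from L'.presheaf.map (eqToHom (U.ι.preimage_image_eq W.unop).symm).op m)) ?_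
    have h2 : U.ι.app (U.ι ''ᵁ W.unop) ≫
        U.toScheme.presheaf.map (eqToHom (U.ι.preimage_image_eq W.unop).symm).op =
        𝟙 (X.presheaf.obj (op (U.ι ''ᵁ W.unop))) := by
      rw [Scheme.Opens.ι_app, Scheme.Opens.toScheme_presheaf_map]
      refine (X.presheaf.map_comp _ _).symm.trans ?_
      exact X.presheaf.map_id _
    exact ConcreteCategory.congr_hom h2 r)
  have hp : ∀ W, IsIso (p.app W) := fun W => by
    change IsIso (L'.presheaf.map _)
    infer_instance
  have : IsIso p := NatIso.isIso_of_isIso_app p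
  have : IsIso q := by
    have : IsIso ((PresheafOfModules.toPresheaf _).map q) := this
    exact isIso_of_reflects_iso q (PresheafOfModules.toPresheaf _)
  exact ⟨asIso q⟩

end
end BigOpen

/-- Let `X` be a noetherian integral locally factorial scheme (all local rings are
UFDs), `U ⊆ X` a big open subscheme (the complement has codimension `≥ 2`, expressed via
chains of specializations), and `L'` a line bundle on `U`.  Then:
(1) `L'` extends to a line bundle `L` on `X`;
(2) such an extension is unique up to a unique isomorphism; and
(3) for any locally free sheaf `F` on `X`, any homomorphism `f' : L' → F|_U` extends
uniquely to a homomorphism `f : L → F`. -/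
theorem line_bundle_extends_from_big_open
    {X : Scheme.{u}} [IsNoetherian X] [IsIntegral X]
    (hfact : ∀ x : X, ∃ _ : IsDomain (X.presheaf.stalk x),
      UniqueFactorizationMonoid (X.presheaf.stalk x))
    (U : X.Opens)
    (hbig : ∀ z : X, z ∉ U →
      ∃ y₁ y₂ : X, y₂ ⤳ y₁ ∧ y₁ ⤳ z ∧ y₁ ≠ z ∧ y₂ ≠ y₁)
    (L' : U.toScheme.Modules) (hL' : IsLineBundle L') :
    (∃ L : X.Modules, IsLineBundle L ∧ Nonempty (pullf U L.val ≅ L'.val)) ∧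
    (∀ (L₁ L₂ : X.Modules), IsLineBundle L₁ → IsLineBundle L₂ →
      ∀ (e₁ : pullf U L₁.val ≅ L'.val) (e₂ : pullf U L₂.val ≅ L'.val),
        ∃! ψ : L₁ ⟶ L₂, IsIso ψ ∧ pullfMap U ψ.val = e₁.hom ≫ e₂.inv) ∧
    (∀ (F : X.Modules), IsLocallyFree F → ∀ (L : X.Modules), IsLineBundle L →
      ∀ (e : pullf U L.val ≅ L'.val) (f' : L'.val ⟶ pullf U F.val),
        ∃! f : L ⟶ F, pullfMap U f.val = e.hom ≫ f') := by
  have hu : ∀ x : X, UniqueFactorizationMonoid (X.presheaf.stalk x) := fun x => (hfact x).2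
  refine ⟨⟨_, BigOpen.pf_lineBundle hu U hbig L' hL', BigOpen.pf_iso U L'⟩, ?_, ?_⟩
  · intro L₁ L₂ h₁ h₂ e₁ e₂
    exact BigOpen.unique_iso hu U hbig L₁ L₂ h₁ h₂ (e₁ ≪≫ e₂.symm)
  · intro F hF L _ e f'
    exact BigOpen.ext_hom hu U hbig L F hF (e.hom ≫ f')
end
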